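/- arXiv:2601.14410 — 2 statements merged into one kernel-verified Lean document; each statement's English description precedes it below -/
import Mathlib

section
/- Let k ≥ 3 and let ψ_1, …, ψ_k be unit vectors in ℂ^d whose pairwise inner products are all equal to a real number γ with (k−2)/(k−1) < γ < 1, i.e., ⟨ψ_i, ψ_j⟩ = γ for all i ≠ j. Then for every positive integer N', the family {ψ_1, …, ψ_k} is antidistinguishable with N' copies if and only if γ^{N'} ≤ (k−2)/(k−1). -/
namespace QSE

noncomputable section

open scoped ComplexOrder

/-- The standard Hermitian inner product `⟨ψ, φ⟩ = ∑ a, conj (ψ a) * φ a` on `I → ℂ`. -/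
def inp {I : Type} [Fintype I] (ψ φ : I → ℂ) : ℂ :=
  ∑ a, (starRingEnd ℂ) (ψ a) * φ a

/-- A family of pure states `ψ 1, …, ψ k` (vectors in a complex Euclidean space indexed by `I`)
is antidistinguishable if there is a POVM `P 1, …, P k` (positive semidefinite matrices summing
to the identity) such that `⟨ψ j, P j ψ j⟩ = 0` for every `j`, and for every `j` there is some
`i` with `⟨ψ i, P j ψ i⟩ ≠ 0`. -/
def Antidistinguishable {I : Type} [Fintype I] [DecidableEq I] {k : ℕ}
    (ψ : Fin k → I → ℂ) : Prop :=
  ∃ P : Fin k → Matrix I I ℂ,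
    (∀ j, (P j).PosSemidef) ∧ (∑ j, P j) = 1 ∧
    (∀ j, inp (ψ j) ((P j).mulVec (ψ j)) = 0) ∧
    (∀ j, ∃ i, inp (ψ i) ((P j).mulVec (ψ i)) ≠ 0)

/-- The concretely realized `N`-th tensor power of `ψ : Fin d → ℂ`: the vector indexed by
functions `f : Fin N → Fin d` whose component at `f` is `∏ t, ψ (f t)`. -/
def tpow {d : ℕ} (ψ : Fin d → ℂ) (N : ℕ) : (Fin N → Fin d) → ℂ :=
  fun f => ∏ t, ψ (f t)

/-- The family `ψ` is antidistinguishable with `N` copies if the family of `N`-th tensor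
powers is antidistinguishable. -/
def AntidistinguishableN {d k : ℕ} (ψ : Fin k → Fin d → ℂ) (N : ℕ) : Prop :=
  Antidistinguishable (fun i => tpow (ψ i) N)

/-- The family `ψ` is `N`-copy antidistinguishable if it is antidistinguishable with `N`
copies but not with any smaller positive number of copies. -/
def NCopyAntidistinguishable {d k : ℕ} (ψ : Fin k → Fin d → ℂ) (N : ℕ) : Prop :=
  AntidistinguishableN ψ N ∧
  ∀ N' : ℕ, 0 < N' → N' < N → ¬ AntidistinguishableN ψ N'


open Matrix

/-- The inner product is multiplicative on tensor powers. -/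
lemma inp_tpow {d : ℕ} (ψ φ : Fin d → ℂ) (N : ℕ) :
    inp (tpow ψ N) (tpow φ N) = inp ψ φ ^ N := by
  simp only [inp, tpow, map_prod, ← Finset.prod_mul_distrib]
  rw [Finset.sum_pow', Fintype.piFinset_univ]

/-- The matrix whose columns are the vectors of the family `φ`. -/
def columns {I K : Type} (φ : K → I → ℂ) : Matrix I K ℂ :=
  Matrix.of fun x i => φ i x

lemma columns_conjTranspose_mul_columns_apply {I K : Type} [Fintype I] (φ : K → I → ℂ) (a b : K) :
    ((columns φ)ᴴ * columns φ) a b = inp (φ a) (φ b) := by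
  simp [Matrix.mul_apply, columns, inp]

lemma columns_conjTranspose_mul_mul_columns_apply {I K : Type} [Fintype I] (φ : K → I → ℂ)
    (P : Matrix I I ℂ) (a b : K) :
    ((columns φ)ᴴ * P * columns φ) a b = inp (φ a) (P.mulVec (φ b)) := by
  rw [Matrix.mul_assoc]
  simp [Matrix.mul_apply, columns, inp, Matrix.mulVec, dotProduct]

section PosSemidef

variable {K : Type} [Fintype K] [DecidableEq K]

/-- A zero diagonal entry of a positive semidefinite matrix forces a zero column. -/
lemma _root_.Matrix.PosSemidef.apply_eq_zero_of_diag_eq_zero {M : Matrix K K ℂ}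
    (hM : M.PosSemidef) {a : K} (h : M a a = 0) (b : K) :
    M b a = 0 := by
  have := (hM.dotProduct_mulVec_zero_iff (Pi.single a 1)).1 (by simpa using h)
  simpa using congrFun this b

/-- The quadratic form of a positive semidefinite matrix is nonnegative at `e a - e b`. -/
lemma _root_.Matrix.PosSemidef.add_le_diag_add_diag {M : Matrix K K ℂ}
    (hM : M.PosSemidef) (a b : K) :
    (M a b).re + (M b a).re ≤ (M a a).re + (M b b).re := by
  have h := hM.dotProduct_mulVec_nonneg (Pi.single a 1 - Pi.single b 1)
  have h' := (Complex.le_def.1 h).1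
  simp [Matrix.mulVec_sub, sub_dotProduct] at h'
  linarith

/-- If the equiangular Gram matrix with off-diagonal entries `c` is a sum of positive semidefinite
matrices `M j` with `M j j j = 0`, then `1 ≤ (k - 1) * (1 - c)`. -/
lemma one_le_mul_one_sub_of_posSemidef_sum [Nontrivial K] (M : K → Matrix K K ℂ) (c : ℝ)
    (hM : ∀ j, (M j).PosSemidef) (hzero : ∀ j, M j j j = 0)
    (hsum : ∀ a b, ∑ j, M j a b = if a = b then 1 else (c : ℂ)) :
    1 ≤ ((Fintype.card K : ℝ) - 1) * (1 - c) := by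
  have hcol (j b) : M j b j = 0 := (hM j).apply_eq_zero_of_diag_eq_zero (hzero j) b
  have hrow (j b) : M j j b = 0 := by
    rw [← (hM j).isHermitian.apply j b, hcol, star_zero]
  have hre (a b) : ∑ j, (M j a b).re = if a = b then 1 else c := by
    rw [← Complex.re_sum, hsum]; split_ifs <;> simp
  have hpair (a b) (hab : a ≠ b) : (M b a a).re + (M a b b).re ≤ 2 * (1 - c) := by
    have hsplit : ∑ j ∈ {a, b}, ((M j a a).re + (M j b b).re - (M j a b).re - (M j b a).re) ≤
        ∑ j, ((M j a a).re + (M j b b).re - (M j a b).re - (M j b a).re) :=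
      Finset.sum_le_univ_sum_of_nonneg fun j => by
        linarith [(hM j).add_le_diag_add_diag a b]
    rw [Finset.sum_pair hab] at hsplit
    simp only [Finset.sum_sub_distrib, Finset.sum_add_distrib, hre, hcol, hrow, hab, hab.symm,
      if_true, if_false, Complex.zero_re] at hsplit
    linarith
  have hcard : (0 : ℝ) < Fintype.card K := by exact_mod_cast Fintype.card_pos
  have htotal : ∑ a : K, ∑ b : K, ((M b a a).re + (M a b b).re) ≤
      ∑ a : K, ∑ b : K, if a = b then 0 else 2 * (1 - c) := by
    refine Finset.sum_le_sum fun a _ => Finset.sum_le_sum fun b _ => ?_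
    split_ifs with hab
    · simp [hab, hzero]
    · exact hpair a b hab
  have hleft : ∑ a : K, ∑ b : K, ((M b a a).re + (M a b b).re) = 2 * Fintype.card K := by
    simp only [Finset.sum_add_distrib]
    rw [Finset.sum_comm (f := fun a b => (M a b b).re)]
    simp [hre]
    ring
  have hright : ∑ a : K, ∑ b : K, (if a = b then 0 else 2 * (1 - c)) =
      Fintype.card K * ((Fintype.card K - 1) * (2 * (1 - c))) := by
    have hinner (a : K) : ∑ b : K, (if a = b then 0 else 2 * (1 - c)) =
        (Fintype.card K - 1) * (2 * (1 - c)) := by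
      simp [Finset.sum_ite, Finset.filter_ne, Finset.card_erase_of_mem, Nat.cast_sub,
        Nat.one_le_iff_ne_zero]
    simp [hinner]
  rw [hleft, hright] at htotal
  nlinarith [htotal, hcard]

lemma sum_ite_or_eq (a b : K) (t : ℂ) :
    ∑ j, (if a = j ∨ b = j then 0 else t) =
      ((Fintype.card K : ℂ) - 2 + if a = b then 1 else 0) * t := by
  have h (j : K) : (if a = j ∨ b = j then 0 else t) =
      t - (if a = j then t else 0) - (if b = j then t else 0) +
        if a = j then (if a = b then t else 0) else 0 := by
    grind
  simp only [h, Finset.sum_add_distrib, Finset.sum_sub_distrib, Finset.sum_ite_eq, Finset.mem_univ,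
    if_true, Finset.sum_const, Finset.card_univ, nsmul_eq_mul]
  split_ifs <;> ring

/-- A decomposition of a positive definite Gram matrix into positive semidefinite matrices lifts
to a POVM on the ambient space. -/
lemma exists_povm_of_posSemidef_sum [Nonempty K] {I : Type} [Fintype I] [DecidableEq I]
    (Φ : Matrix I K ℂ) (hΦ : (Φᴴ * Φ).PosDef) (M : K → Matrix K K ℂ)
    (hM : ∀ j, (M j).PosSemidef) (hsum : ∑ j, M j = Φᴴ * Φ) :
    ∃ P : K → Matrix I I ℂ, (∀ j, (P j).PosSemidef) ∧ ∑ j, P j = 1 ∧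
      ∀ j, Φᴴ * P j * Φ = M j := by
  set G := Φᴴ * Φ with hG
  have hdet : IsUnit G.det := (Matrix.isUnit_iff_isUnit_det G).1 hΦ.isUnit
  set X := Φ * G⁻¹ with hX
  have hGinv : (G⁻¹)ᴴ = G⁻¹ := hΦ.isHermitian.inv
  have hXΦ : Xᴴ * Φ = 1 := by
    rw [hX, conjTranspose_mul, hGinv, Matrix.mul_assoc, ← hG, nonsing_inv_mul _ hdet]
  have hΦX : Φᴴ * X = 1 := by
    rw [hX, ← Matrix.mul_assoc, ← hG, mul_nonsing_inv _ hdet]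
  have hXG : X * G = Φ := by
    rw [hX, Matrix.mul_assoc, nonsing_inv_mul _ hdet, Matrix.mul_one]
  set Q : Matrix I I ℂ := 1 - X * G * Xᴴ with hQ
  have hQΦ : Q * Φ = 0 := by
    rw [hQ, Matrix.sub_mul, Matrix.mul_assoc, hXΦ, hXG]; simp
  have hQherm : Qᴴ = Q := by
    have := (isHermitian_mul_mul_conjTranspose X hΦ.isHermitian).eq
    rw [hQ, conjTranspose_sub, this, conjTranspose_one]
  have hQidem : Qᴴ * Q = Q := by
    rw [hQherm]
    conv_lhs => rw [hQ, Matrix.mul_sub, ← hQ, hXG, ← Matrix.mul_assoc, hQΦ]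
    simp
  have hQpos : Q.PosSemidef := hQidem ▸ posSemidef_conjTranspose_mul_self Q
  have hcard : (Fintype.card K : ℝ) ≠ 0 := by exact_mod_cast Fintype.card_ne_zero
  refine ⟨fun j => X * M j * Xᴴ + (Fintype.card K : ℝ)⁻¹ • Q, fun j => ?_, ?_, fun j => ?_⟩
  · exact ((hM j).mul_mul_conjTranspose_same X).add (hQpos.smul (by positivity))
  · rw [Finset.sum_add_distrib, ← Matrix.sum_mul, ← Matrix.mul_sum, hsum, Finset.sum_const,
      Finset.card_univ, ← Nat.cast_smul_eq_nsmul ℝ, smul_smul, mul_inv_cancel₀ hcard, one_smul, hQ]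
    abel
  · calc Φᴴ * (X * M j * Xᴴ + (Fintype.card K : ℝ)⁻¹ • Q) * Φ
        = (Φᴴ * X) * M j * (Xᴴ * Φ) + (Fintype.card K : ℝ)⁻¹ • (Φᴴ * (Q * Φ)) := by
          simp [Matrix.mul_add, Matrix.add_mul, Matrix.mul_assoc]
      _ = M j := by simp [hΦX, hXΦ, hQΦ]

end PosSemidef

/-- `k ≥ 3` unit vectors with equal real inner products `c ∈ [0, 1)` are antidistinguishable iff
`c ≤ (k - 2) / (k - 1)`. -/
theorem antidistinguishable_iff_of_equiangular {I : Type} [Fintype I] [DecidableEq I] {k : ℕ}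
    (hk : 3 ≤ k) (φ : Fin k → I → ℂ) (c : ℝ) (hc₀ : 0 ≤ c) (hc₁ : c < 1)
    (hφ : ∀ a b, inp (φ a) (φ b) = if a = b then 1 else (c : ℂ)) :
    Antidistinguishable φ ↔ c ≤ ((k : ℝ) - 2) / ((k : ℝ) - 1) := by
  have hk' : (3 : ℝ) ≤ k := by exact_mod_cast hk
  have : Nontrivial (Fin k) := Fin.nontrivial_iff_two_le.2 (by lia)
  rw [le_div_iff₀ (by linarith)]
  constructor
  · rintro ⟨P, hP, hsum, hzero, -⟩
    have := one_le_mul_one_sub_of_posSemidef_sum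
      (fun j => (columns φ)ᴴ * P j * columns φ) c
      (fun j => (hP j).conjTranspose_mul_mul_same _)
      (fun j => by rw [columns_conjTranspose_mul_mul_columns_apply, hzero])
      (fun a b => by
        rw [← Matrix.sum_apply, ← Matrix.sum_mul, ← Matrix.mul_sum, hsum, Matrix.mul_one,
          columns_conjTranspose_mul_columns_apply, hφ])
    rw [Fintype.card_fin] at this
    linarith
  · intro hc
    set α : ℝ := 1 / (k - 1) - c / (k - 2) with hα
    set β : ℝ := c / (k - 2) with hβ
    have hβ₀ : 0 ≤ β := div_nonneg hc₀ (by linarith)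
    have hα₀ : 0 ≤ α := by
      rw [hα, sub_nonneg, div_le_div_iff₀ (by linarith) (by linarith)]
      linarith
    let v (j : Fin k) : Fin k → ℂ := fun a => if a = j then 0 else 1
    let M (j : Fin k) : Matrix (Fin k) (Fin k) ℂ :=
      α • Matrix.diagonal (v j) + β • Matrix.vecMulVec (v j) (star (v j))
    have hMpos (j) : (M j).PosSemidef := by
      refine (PosSemidef.smul (.diagonal fun a => ?_) hα₀).add
        ((posSemidef_vecMulVec_self_star _).smul hβ₀)
      by_cases h : a = j <;> simp [v, h]
    have hMapply (j a b) : M j a b =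
        if a = j ∨ b = j then 0 else if a = b then ((α + β : ℝ) : ℂ) else (β : ℂ) := by
      by_cases ha : a = j <;> by_cases hb : b = j <;> by_cases hab : a = b <;>
        simp_all [M, v, Matrix.vecMulVec_apply]
    have hgram : ∑ j, M j = (columns φ)ᴴ * columns φ := by
      ext a b
      rw [columns_conjTranspose_mul_columns_apply, hφ, Matrix.sum_apply]
      simp only [hMapply, sum_ite_or_eq, Fintype.card_fin]
      have hne₁ : (k : ℝ) - 1 ≠ 0 := by linarith
      have hne₂ : (k : ℝ) - 2 ≠ 0 := by linarith
      split_ifs with hab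
      · have : ((k : ℝ) - 2 + 1) * (α + β) = 1 := by
          rw [hα]
          field_simp
          ring
        exact_mod_cast congrArg Complex.ofReal this
      · have : ((k : ℝ) - 2 + 0) * β = c := by
          rw [hβ]
          field_simp
          ring
        exact_mod_cast congrArg Complex.ofReal this
    have hpos : ((columns φ)ᴴ * columns φ).PosDef := by
      have heq : (columns φ)ᴴ * columns φ =
          (1 - c) • (1 : Matrix (Fin k) (Fin k) ℂ) +
            c • Matrix.vecMulVec (fun _ => (1 : ℂ)) (star fun _ => (1 : ℂ)) := by
        ext a b
        rw [columns_conjTranspose_mul_columns_apply, hφ]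
        by_cases hab : a = b <;> simp [hab, Matrix.vecMulVec_apply]
      rw [heq]
      exact (PosDef.one.smul (sub_pos.2 hc₁)).add_posSemidef
        ((posSemidef_vecMulVec_self_star _).smul hc₀)
    obtain ⟨P, hP, hsum, hPM⟩ := exists_povm_of_posSemidef_sum (columns φ) hpos M hMpos hgram
    refine ⟨P, hP, hsum, fun j => ?_, fun j => ?_⟩
    · rw [← columns_conjTranspose_mul_mul_columns_apply, hPM, hMapply]
      simp
    · obtain ⟨i, hi⟩ := exists_ne j
      refine ⟨i, ?_⟩
      rw [← columns_conjTranspose_mul_mul_columns_apply, hPM, hMapply]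
      have hαβ : α + β ≠ 0 := by
        rw [hα, sub_add_cancel]
        exact (one_div_pos.2 (by linarith)).ne'
      simpa only [hi, or_self, if_true, if_false] using Complex.ofReal_ne_zero.2 hαβ

/-- For `k ≥ 3` unit vectors with equal real inner products `γ ∈ ((k-2)/(k-1), 1)`, the
family is antidistinguishable with `N'` copies iff `γ^N' ≤ (k-2)/(k-1)`. -/
theorem stmt11 {d k : ℕ} (hk : 3 ≤ k) (ψ : Fin k → Fin d → ℂ)
    (hunit : ∀ i, inp (ψ i) (ψ i) = 1)
    (γ : ℝ) (hγl : ((k : ℝ) - 2) / ((k : ℝ) - 1) < γ) (hγu : γ < 1)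
    (hinner : ∀ i j, i ≠ j → inp (ψ i) (ψ j) = (γ : ℂ)) :
    ∀ N' : ℕ, 0 < N' →
      (AntidistinguishableN ψ N' ↔ γ ^ N' ≤ ((k : ℝ) - 2) / ((k : ℝ) - 1)) := by
  intro N hN
  have hk' : (3 : ℝ) ≤ k := by exact_mod_cast hk
  have hγ₀ : 0 < γ := (div_pos (by linarith) (by linarith)).trans hγl
  refine antidistinguishable_iff_of_equiangular hk _ (γ ^ N) (by positivity)
    (pow_lt_one₀ hγ₀.le hγu hN.ne') fun a b => ?_
  rw [inp_tpow]
  split_ifs with hab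
  · rw [hab, hunit, one_pow]
  · rw [hinner a b hab, Complex.ofReal_pow]

end

end QSE
end

section
/- Consider the three unit vectors in ℂ², |0⟩ = (1,0), |+⟩ = (1/√2)(1,1), and |1⟩ = (0,1). The family {|0⟩, |+⟩, |1⟩} is not antidistinguishable, but it is antidistinguishable with 2 copies (i.e., the family {|0⟩^{⊗2}, |+⟩^{⊗2}, |1⟩^{⊗2}} is antidistinguishable); hence it is 2-copy antidistinguishable. -/
namespace QSE

noncomputable section

open scoped ComplexOrder

/-- A positive semidefinite matrix annihilates every vector on which its quadratic form vanishes. -/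
lemma mulVec_eq_zero_of_inp_eq_zero {I : Type} [Fintype I] {P : Matrix I I ℂ}
    (hP : P.PosSemidef) {v : I → ℂ} (h : inp v (P.mulVec v) = 0) : P.mulVec v = 0 :=
  (hP.dotProduct_mulVec_zero_iff v).1 h

/-- Two orthogonal basis states of a qubit and their equal superposition are never
antidistinguishable: the element of the POVM excluding the superposition has to vanish. -/
lemma not_antidistinguishable_of_equiv {I : Type} [Fintype I] [DecidableEq I] (e : Fin 2 ≃ I)
    {c : ℂ} (hc : c ≠ 0) (φ : Fin 3 → I → ℂ)
    (hφ : ∀ j i, φ j (e i) = (![![1, 0], ![c, c], ![0, 1]] : Fin 3 → Fin 2 → ℂ) j i) :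
    ¬ Antidistinguishable φ := by
  rintro ⟨P, hP, hsum, hzero, hne⟩
  have key : ∀ j x, P j x (e 0) * φ j (e 0) + P j x (e 1) * φ j (e 1) = 0 := by
    intro j x
    have h := congrFun (mulVec_eq_zero_of_inp_eq_zero (hP j) (hzero j)) x
    simpa [Matrix.mulVec, dotProduct, ← e.sum_comp] using h
  simp only [hφ] at key
  have h0 : ∀ x, P 0 x (e 0) = 0 := fun x => by simpa using key 0 x
  have h2 : ∀ x, P 2 x (e 1) = 0 := fun x => by simpa using key 2 x
  have h1 : ∀ x, P 1 x (e 0) + P 1 x (e 1) = 0 := fun x => by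
    have h := key 1 x
    simp only [Matrix.cons_val_one, Matrix.cons_val_zero, ← add_mul] at h
    exact (mul_eq_zero.1 h).resolve_right hc
  have h001 : P 0 (e 0) (e 1) = 0 := by
    rw [← (hP 0).isHermitian.apply, h0, star_zero]
  have h101 : P 1 (e 0) (e 1) = 0 := by
    have h := congrFun (congrFun hsum (e 0)) (e 1)
    simpa [Fin.sum_univ_three, h001, h2] using h
  have h110 : P 1 (e 1) (e 0) = 0 := by
    rw [← (hP 1).isHermitian.apply, h101, star_zero]
  have h100 : P 1 (e 0) (e 0) = 0 := by simpa [h101] using h1 (e 0)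
  have h111 : P 1 (e 1) (e 1) = 0 := by simpa [h110] using h1 (e 1)
  have hP1 : P 1 = 0 := by
    ext x y
    obtain ⟨x, rfl⟩ := e.surjective x
    obtain ⟨y, rfl⟩ := e.surjective y
    fin_cases x <;> fin_cases y <;> simp [*]
  obtain ⟨i, hi⟩ := hne 1
  simp [hP1, inp] at hi

/-- The vector on pairs of qubit indices with the entries of a given matrix. -/
def twoQubit (M : Matrix (Fin 2) (Fin 2) ℂ) : (Fin 2 → Fin 2) → ℂ :=
  fun f => M (f 0) (f 1)

lemma sum_two_qubit (g : (Fin 2 → Fin 2) → ℂ) :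
    ∑ f, g f = g ![0, 0] + g ![0, 1] + g ![1, 0] + g ![1, 1] := by
  rw [← (finTwoArrowEquiv (Fin 2)).symm.sum_comp, Fintype.sum_prod_type]
  simp [finTwoArrowEquiv, add_assoc]

/-- The rank-one positive semidefinite matrix of the vector `twoQubit M`. -/
def outer (M : Matrix (Fin 2) (Fin 2) ℂ) : Matrix (Fin 2 → Fin 2) (Fin 2 → Fin 2) ℂ :=
  Matrix.vecMulVec (twoQubit M) (star (twoQubit M))

lemma outer_posSemidef (M : Matrix (Fin 2) (Fin 2) ℂ) : (outer M).PosSemidef :=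
  Matrix.posSemidef_vecMulVec_self_star _

/-- A POVM on two qubits excluding `|00⟩`, `|++⟩` and `|11⟩` respectively. -/
def twoCopyPOVM : Fin 3 → Matrix (Fin 2 → Fin 2) (Fin 2 → Fin 2) ℂ :=
  ![outer !![0, 0; 0, 1],
    (1 / 2 : ℂ) • outer !![1, -1; 0, 0],
    outer !![0, 0; 1, 0] + (1 / 2 : ℂ) • outer !![1, 1; 0, 0]]

lemma twoCopyPOVM_posSemidef (j : Fin 3) : (twoCopyPOVM j).PosSemidef := by
  have half : (0 : ℂ) ≤ 1 / 2 := by positivity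
  fin_cases j
  · exact outer_posSemidef _
  · exact (outer_posSemidef _).smul half
  · exact (outer_posSemidef _).add ((outer_posSemidef _).smul half)

lemma sum_twoCopyPOVM : ∑ j, twoCopyPOVM j = 1 := by
  ext f g
  obtain ⟨⟨a, b⟩, rfl⟩ := (finTwoArrowEquiv (Fin 2)).symm.surjective f
  obtain ⟨⟨c, d⟩, rfl⟩ := (finTwoArrowEquiv (Fin 2)).symm.surjective g
  fin_cases a <;> fin_cases b <;> fin_cases c <;> fin_cases d <;>
    simp [Fin.sum_univ_three, twoCopyPOVM, outer, twoQubit, Matrix.vecMulVec_apply,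
      finTwoArrowEquiv] <;>
    norm_num

lemma antidistinguishableN_two {c : ℂ} :
    AntidistinguishableN (![![1, 0], ![c, c], ![0, 1]] : Fin 3 → Fin 2 → ℂ) 2 := by
  refine ⟨twoCopyPOVM, twoCopyPOVM_posSemidef, sum_twoCopyPOVM, fun j => ?_,
    fun j => ⟨![2, 0, 0] j, ?_⟩⟩ <;>
  fin_cases j <;>
    simp [inp, Matrix.mulVec, dotProduct, sum_two_qubit, tpow, twoCopyPOVM, outer, twoQubit,
      Matrix.vecMulVec_apply]

/-- The family `{|0⟩, |+⟩, |1⟩}` of qubit states is not antidistinguishable, but it is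
antidistinguishable with 2 copies; hence it is 2-copy antidistinguishable. -/
theorem stmt19 (ψ : Fin 3 → Fin 2 → ℂ)
    (hψ : ψ = ![![1, 0],
                ![(Real.sqrt 2 : ℂ)⁻¹, (Real.sqrt 2 : ℂ)⁻¹],
                ![0, 1]]) :
    ¬ Antidistinguishable ψ ∧
    AntidistinguishableN ψ 2 ∧
    NCopyAntidistinguishable ψ 2 := by
  subst hψ
  have hc : (Real.sqrt 2 : ℂ)⁻¹ ≠ 0 := by simp
  refine ⟨not_antidistinguishable_of_equiv (Equiv.refl _) hc _ fun _ _ => rfl,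
    antidistinguishableN_two, antidistinguishableN_two, fun N hN hN2 => ?_⟩
  obtain rfl : N = 1 := by omega
  exact not_antidistinguishable_of_equiv (Equiv.funUnique (Fin 1) (Fin 2)).symm hc _
    fun _ _ => by simp [tpow]

end

end QSE
end
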